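/- arXiv:1508.05835 — 2 statements merged into one kernel-verified Lean document; each statement's English description precedes it below -/
import Mathlib

section
/- Let A be a nonempty index set, θ > 0, M ≥ 0, and m, s : A → ℝ with |m(α)| ≤ M and |s(α)| ≤ M for all α ∈ A. Define V(ψ) := ⨆_{α∈A} ( (1 − 2θψ) m(α) − θ s(α) ), ψ_min := −⨆_{α∈A} m(α) and ψ_max := −⨅_{α∈A} m(α). Then ⨆_{ψ∈ℝ} ( V(ψ) − θψ² ) = ⨆_{ψ ∈ [ψ_min, ψ_max]} ( V(ψ) − θψ² ). -/
/-- The external static optimization over the dual variable `ψ` may be restricted to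
the compact interval `[ψ_min, ψ_max] = [−⨆_α m(α), −⨅_α m(α)]`. -/
theorem external_sup_restrict_to_interval
    {A : Type*} [Nonempty A] (θ M : ℝ) (hθ : 0 < θ) (hM : 0 ≤ M)
    (m s : A → ℝ) (hm : ∀ α, |m α| ≤ M) (hs : ∀ α, |s α| ≤ M) :
    (⨆ ψ : ℝ, ((⨆ α, ((1 - 2 * θ * ψ) * m α - θ * s α)) - θ * ψ ^ 2))
      = ⨆ ψ : Set.Icc (-(⨆ α, m α)) (-(⨅ α, m α)),
          ((⨆ α, ((1 - 2 * θ * (ψ : ℝ)) * m α - θ * s α)) - θ * (ψ : ℝ) ^ 2) := by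
  have hmabove : BddAbove (Set.range m) :=
    ⟨M, Set.forall_mem_range.2 fun α => (abs_le.1 (hm α)).2⟩
  have hmbelow : BddBelow (Set.range m) :=
    ⟨-M, Set.forall_mem_range.2 fun α => (abs_le.1 (hm α)).1⟩
  have hpayoff : ∀ ψ : ℝ,
      BddAbove (Set.range fun α => (1 - 2 * θ * ψ) * m α - θ * s α) := by
    refine fun ψ => ⟨|1 - 2 * θ * ψ| * M + θ * M, Set.forall_mem_range.2 fun α => ?_⟩
    have h₁ : (1 - 2 * θ * ψ) * m α ≤ |1 - 2 * θ * ψ| * M :=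
      (le_abs_self _).trans <| by
        rw [abs_mul]
        exact mul_le_mul_of_nonneg_left (hm α) (abs_nonneg _)
    have h₂ : θ * -M ≤ θ * s α := mul_le_mul_of_nonneg_left (abs_le.1 (hs α)).1 hθ.le
    linarith
  set F : ℝ → ℝ := fun ψ => (⨆ α, ((1 - 2 * θ * ψ) * m α - θ * s α)) - θ * ψ ^ 2
  have hle : ∀ ψ, F ψ ≤ M + θ * M + θ * M ^ 2 := by
    refine fun ψ => sub_le_iff_le_add.2 (ciSup_le fun α => ?_)
    have h₁ : θ * -M ≤ θ * s α := mul_le_mul_of_nonneg_left (abs_le.1 (hs α)).1 hθ.le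
    have h₂ : θ * m α ^ 2 ≤ θ * M ^ 2 :=
      mul_le_mul_of_nonneg_left (sq_le_sq.2 ((hm α).trans (le_abs_self M))) hθ.le
    have h₃ : 0 ≤ θ * (ψ + m α) ^ 2 := by positivity
    linarith [(abs_le.1 (hm α)).2]
  have hmem : ∀ α, -m α ∈ Set.Icc (-(⨆ α, m α)) (-(⨅ α, m α)) := fun α =>
    ⟨neg_le_neg (le_ciSup hmabove α), neg_le_neg (ciInf_le hmbelow α)⟩
  have hbdd : BddAbove (Set.range F) := ⟨_, Set.forall_mem_range.2 hle⟩
  have hbdd' : BddAbove (Set.range fun ψ : Set.Icc (-(⨆ α, m α)) (-(⨅ α, m α)) => F ψ) :=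
    ⟨_, Set.forall_mem_range.2 fun ψ => hle ψ⟩
  have : Nonempty (Set.Icc (-(⨆ α, m α)) (-(⨅ α, m α))) :=
    ⟨⟨_, hmem (Classical.arbitrary A)⟩⟩
  change (⨆ ψ, F ψ) = ⨆ ψ : Set.Icc (-(⨆ α, m α)) (-(⨅ α, m α)), F ψ
  refine le_antisymm (ciSup_le fun ψ => ?_) (ciSup_le fun ψ => le_ciSup hbdd (ψ : ℝ))
  refine sub_le_iff_le_add.2 (ciSup_le fun α => ?_)
  -- For fixed `α`, completing the square shows that `ψ = -m α` is optimal.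
  have h₁ : F (-m α) ≤ ⨆ ψ : Set.Icc (-(⨆ α, m α)) (-(⨅ α, m α)), F ψ :=
    le_ciSup hbdd' ⟨_, hmem α⟩
  have h₂ : (1 - 2 * θ * -m α) * m α - θ * s α - θ * (-m α) ^ 2 ≤ F (-m α) :=
    sub_le_sub_right (le_ciSup (hpayoff (-m α)) α) _
  have h₃ : 0 ≤ θ * (ψ + m α) ^ 2 := by positivity
  linarith
end

section
/- Let A be a nonempty index set, θ > 0, M ≥ 0, and m, s : A → ℝ with |m(α)| ≤ M and |s(α)| ≤ M for all α ∈ A. Define V(ψ) := ⨆_{α∈A} ( (1 − 2θψ) m(α) − θ s(α) ) and h(ψ) := V(ψ) − θψ². Then h is non-increasing on the interval [−⨅_{α} m(α), ∞) and non-decreasing on the interval (−∞, −⨆_{α} m(α)]; that is, for ψ_max := −⨅_α m(α) ≤ ψ ≤ ψ' one has h(ψ') ≤ h(ψ), and for ψ' ≤ ψ ≤ ψ_min := −⨆_α m(α) one has h(ψ') ≤ h(ψ). -/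
/-- The family of affine payoffs `(1 - 2θψ) m(α) - θ s(α)` is bounded above when `m` and `s`
are bounded. -/
theorem bddAbove_range_affine_payoff {A : Type*} {M : ℝ} {m s : A → ℝ}
    (hm : ∀ α, |m α| ≤ M) (hs : ∀ α, |s α| ≤ M) (θ ψ : ℝ) :
    BddAbove (Set.range fun α => (1 - 2 * θ * ψ) * m α - θ * s α) := by
  refine ⟨|1 - 2 * θ * ψ| * M + |θ| * M, ?_⟩
  rintro _ ⟨α, rfl⟩
  calc (1 - 2 * θ * ψ) * m α - θ * s α
      ≤ |(1 - 2 * θ * ψ) * m α| + |θ * s α| := by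
        linarith [le_abs_self ((1 - 2 * θ * ψ) * m α), neg_abs_le (θ * s α)]
    _ ≤ |1 - 2 * θ * ψ| * M + |θ| * M := by
        rw [abs_mul, abs_mul]
        gcongr
        · exact hm α
        · exact hs α

/-- The external objective does not increase from `ψ` to `ψ'` if
`(ψ' - ψ) (2 m(α) + ψ + ψ')` is nonnegative for every `α`. -/
theorem external_objective_le {A : Type*} [Nonempty A] {θ M : ℝ} (hθ : 0 ≤ θ)
    {m s : A → ℝ} (hm : ∀ α, |m α| ≤ M) (hs : ∀ α, |s α| ≤ M) {ψ ψ' : ℝ}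
    (h : ∀ α, 0 ≤ (ψ' - ψ) * (2 * m α + ψ + ψ')) :
    (⨆ α, ((1 - 2 * θ * ψ') * m α - θ * s α)) - θ * ψ' ^ 2
      ≤ (⨆ α, ((1 - 2 * θ * ψ) * m α - θ * s α)) - θ * ψ ^ 2 := by
  rw [sub_le_iff_le_add]
  refine ciSup_le fun α => ?_
  have hα := le_ciSup (bddAbove_range_affine_payoff hm hs θ ψ) α
  linarith [mul_nonneg hθ (h α)]

/-- Monotonicity of the external objective `h(ψ) = V(ψ) − θψ²` outside
`[ψ_min, ψ_max]`: `h` is non-increasing on `[−⨅_α m(α), ∞)` and non-decreasing on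
`(−∞, −⨆_α m(α)]`. -/
theorem external_objective_monotone_outside
    {A : Type*} [Nonempty A] (θ M : ℝ) (hθ : 0 < θ) (hM : 0 ≤ M)
    (m s : A → ℝ) (hm : ∀ α, |m α| ≤ M) (hs : ∀ α, |s α| ≤ M) :
    (∀ ψ ψ' : ℝ, -(⨅ α, m α) ≤ ψ → ψ ≤ ψ' →
        (⨆ α, ((1 - 2 * θ * ψ') * m α - θ * s α)) - θ * ψ' ^ 2
          ≤ (⨆ α, ((1 - 2 * θ * ψ) * m α - θ * s α)) - θ * ψ ^ 2) ∧
    (∀ ψ ψ' : ℝ, ψ' ≤ ψ → ψ ≤ -(⨆ α, m α) →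
        (⨆ α, ((1 - 2 * θ * ψ') * m α - θ * s α)) - θ * ψ' ^ 2
          ≤ (⨆ α, ((1 - 2 * θ * ψ) * m α - θ * s α)) - θ * ψ ^ 2) := by
  constructor
  · intro ψ ψ' hψ hle
    refine external_objective_le hθ.le hm hs fun α => ?_
    have hα : (⨅ α, m α) ≤ m α :=
      ciInf_le ⟨-M, Set.forall_mem_range.2 fun β => (abs_le.1 (hm β)).1⟩ α
    exact mul_nonneg (by linarith) (by linarith)
  · intro ψ ψ' hle hψ
    refine external_objective_le hθ.le hm hs fun α => ?_
    have hα : m α ≤ ⨆ α, m α :=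
      le_ciSup ⟨M, Set.forall_mem_range.2 fun β => (abs_le.1 (hm β)).2⟩ α
    exact mul_nonneg_of_nonpos_of_nonpos (by linarith) (by linarith)
end
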